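/- arXiv:2012.09956 — 7 statements merged into one kernel-verified Lean document; each statement's English description precedes it below -/
import Mathlib

section
/- For every positive integer n and every SED-pair (G,f) of order n, the total weight satisfies s[(G,f)] ≥ -n²/25. -/
open Finset

/-- The value `s_v`: the sum of weights of edges incident to `v`. -/
def sVert {V : Type*} [Fintype V] [DecidableEq V] (G : SimpleGraph V) [DecidableRel G.Adj]
    (f : Sym2 V → ℤ) (v : V) : ℤ :=
  ∑ e ∈ G.edgeFinset.filter (fun e => v ∈ e), f e

/-- The total weight `s[(G,f)]`: the sum of weights over all edges. -/
def sSum {V : Type*} [Fintype V] [DecidableEq V] (G : SimpleGraph V) [DecidableRel G.Adj]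
    (f : Sym2 V → ℤ) : ℤ :=
  ∑ e ∈ G.edgeFinset, f e

/-- `(G, f)` is a SED-pair: `f` takes values `±1` on edges, and the sum of `f` over the
closed edge-neighborhood `N[e]` (edges sharing a vertex with `e`, including `e` itself)
is at least `1` for every edge `e`. -/
def IsSEDPair {V : Type*} [Fintype V] [DecidableEq V] (G : SimpleGraph V) [DecidableRel G.Adj]
    (f : Sym2 V → ℤ) : Prop :=
  (∀ e ∈ G.edgeFinset, f e = 1 ∨ f e = -1) ∧
  (∀ e ∈ G.edgeFinset,
    1 ≤ ∑ e' ∈ G.edgeFinset.filter (fun e' => ∃ v, v ∈ e ∧ v ∈ e'), f e')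

section RealInequality

/-- The extremal inequality on the conic `a ^ 2 = m ^ 2 + b * m`. -/
lemma mul_sub_sq_le_of_sq_eq {a b m : ℝ} (ha : 0 ≤ a) (hm : 0 < m)
    (h : a ^ 2 = m ^ 2 + b * m) : b * m - m ^ 2 ≤ 2 / 25 * (a + b) ^ 2 := by
  have hfac : m ^ 2 * (2 / 25 * (a + b) ^ 2 - (b * m - m ^ 2)) =
      2 / 25 * (a - 2 * m) ^ 2 * (a ^ 2 + 6 * a * m + 13 / 2 * m ^ 2) := by
    have hbm : b * m = a ^ 2 - m ^ 2 := by linarith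
    calc m ^ 2 * (2 / 25 * (a + b) ^ 2 - (b * m - m ^ 2))
        = 2 / 25 * (a * m + b * m) ^ 2 - m ^ 2 * (b * m - m ^ 2) := by ring
      _ = _ := by rw [hbm]; ring
  have hpos : 0 ≤ m ^ 2 * (2 / 25 * (a + b) ^ 2 - (b * m - m ^ 2)) := by
    rw [hfac]; positivity
  linarith [nonneg_of_mul_nonneg_right hpos (by positivity)]

/-- If `t` is at most both `b * m` and `a ^ 2 - p`, where `p ≥ m ^ 2`, then `t - p` is at most
`2 / 25 * (a + b) ^ 2`. -/
lemma sub_le_of_le_mul_of_add_le_sq {a b m p t : ℝ} (hb : 0 ≤ b) (hm : 0 < m)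
    (hma : m ≤ a) (hp : m ^ 2 ≤ p) (ht : t ≤ b * m) (hpt : p + t ≤ a ^ 2) :
    t - p ≤ 2 / 25 * (a + b) ^ 2 := by
  have ha : 0 ≤ a := hm.le.trans hma
  rcases le_total (m ^ 2 + b * m) (a ^ 2) with hle | hle
  · have hr := Real.sq_sqrt (show 0 ≤ m ^ 2 + b * m by positivity)
    have hra : √(m ^ 2 + b * m) ≤ a := Real.sqrt_le_iff.2 ⟨ha, hle⟩
    have hkey := mul_sub_sq_le_of_sq_eq (Real.sqrt_nonneg _) hm hr
    have hmono : (√(m ^ 2 + b * m) + b) ^ 2 ≤ (a + b) ^ 2 := by gcongr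
    linarith
  · have hc : (a ^ 2 - m ^ 2) / m * m = a ^ 2 - m ^ 2 := div_mul_cancel₀ _ hm.ne'
    have hc0 : 0 ≤ (a ^ 2 - m ^ 2) / m :=
      div_nonneg (by linarith [pow_le_pow_left₀ hm.le hma 2]) hm.le
    have hcb : (a ^ 2 - m ^ 2) / m ≤ b := (div_le_iff₀ hm).2 (by linarith)
    have hkey := mul_sub_sq_le_of_sq_eq ha hm (b := (a ^ 2 - m ^ 2) / m) (by linarith)
    have hmono : (a + (a ^ 2 - m ^ 2) / m) ^ 2 ≤ (a + b) ^ 2 := by gcongr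
    linarith

end RealInequality

section SignedGraph

variable {V : Type*} [Fintype V] [DecidableEq V] (G : SimpleGraph V) [DecidableRel G.Adj]
  (f : Sym2 V → ℤ)

lemma sVert_eq_sum_neighborFinset (v : V) :
    sVert G f v = ∑ u ∈ G.neighborFinset v, f s(v, u) := by
  symm
  refine Finset.sum_bij (fun u _ => s(v, u)) ?_ ?_ ?_ ?_
  · intro u hu
    simpa using hu
  · intro u _ w _ huw
    exact Sym2.congr_right.1 huw
  · intro e he
    obtain ⟨he, hv⟩ := Finset.mem_filter.1 he
    obtain ⟨u, rfl⟩ := hv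
    exact ⟨u, by simpa using he, rfl⟩
  · intros; rfl

lemma sVert_eq_sum_ite (v : V) :
    sVert G f v = ∑ u, if G.Adj v u then f s(v, u) else 0 := by
  rw [sVert_eq_sum_neighborFinset, ← Finset.sum_filter, SimpleGraph.neighborFinset_eq_filter]

lemma sum_sVert_eq_two_mul_sSum : ∑ v, sVert G f v = 2 * sSum G f := by
  simp only [sVert, sSum, Finset.sum_filter]
  rw [Finset.sum_comm, Finset.mul_sum]
  refine Finset.sum_congr rfl fun e he => ?_
  have hcard : #(univ.filter (· ∈ e)) = 2 := by
    rw [← Sym2.card_toFinset_of_not_isDiag e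
      (G.not_isDiag_of_mem_edgeSet (SimpleGraph.mem_edgeFinset.1 he))]
    congr 1
    ext v
    simp
  rw [← Finset.sum_filter, Finset.sum_const, hcard]
  simp

variable {G f}

/-- The domination condition at the edge `uv`, in terms of the vertex sums. -/
lemma IsSEDPair.one_add_le_sVert_add (h : IsSEDPair G f) {u v : V} (huv : G.Adj u v) :
    1 + f s(u, v) ≤ sVert G f u + sVert G f v := by
  have hdom := h.2 s(u, v) (by simpa using huv)
  have hunion : G.edgeFinset.filter (fun e' => ∃ w, w ∈ s(u, v) ∧ w ∈ e') =
      G.edgeFinset.filter (u ∈ ·) ∪ G.edgeFinset.filter (v ∈ ·) := by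
    ext e
    simp [and_or_left]
  have hinter : G.edgeFinset.filter (u ∈ ·) ∩ G.edgeFinset.filter (v ∈ ·) = {s(u, v)} := by
    ext e
    simp only [Finset.mem_inter, Finset.mem_filter, Finset.mem_singleton]
    constructor
    · rintro ⟨⟨_, hu⟩, _, hv⟩
      exact (Sym2.mem_and_mem_iff huv.ne).1 ⟨hu, hv⟩
    · rintro rfl
      simpa using huv
  have hsum := Finset.sum_union_inter (s₁ := G.edgeFinset.filter (u ∈ ·))
    (s₂ := G.edgeFinset.filter (v ∈ ·)) (f := f)
  rw [hinter, ← hunion, Finset.sum_singleton] at hsum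
  simp only [sVert]
  linarith

lemma IsSEDPair.sVert_add_nonneg (h : IsSEDPair G f) {u v : V} (huv : G.Adj u v) :
    0 ≤ sVert G f u + sVert G f v := by
  have hsum := h.one_add_le_sVert_add huv
  rcases h.1 s(u, v) (by simpa using huv) with hf | hf <;> omega

lemma IsSEDPair.neg_sVert_le_degree (h : IsSEDPair G f) (v : V) :
    -sVert G f v ≤ #(G.neighborFinset v) := by
  rw [sVert_eq_sum_neighborFinset, ← Finset.sum_neg_distrib]
  refine (Finset.sum_le_card_nsmul _ _ 1 fun u hu => ?_).trans (by simp)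
  rcases h.1 s(v, u) (by simpa using hu) with hf | hf <;> omega

lemma IsSEDPair.neighborFinset_subset (h : IsSEDPair G f) {v : V} (hv : sVert G f v < 0) :
    G.neighborFinset v ⊆ univ.filter (0 ≤ sVert G f ·) := by
  intro u hu
  have huv := h.sVert_add_nonneg ((G.mem_neighborFinset v u).1 hu)
  simp only [Finset.mem_filter, Finset.mem_univ, true_and]
  omega

/-- A vertex of negative sum `-m` has at least `m` neighbours, each of sum at least `m`. -/
lemma IsSEDPair.sVert_sq_le_sum (h : IsSEDPair G f) {v : V} (hv : sVert G f v < 0) :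
    sVert G f v ^ 2 ≤ ∑ u ∈ univ.filter (0 ≤ sVert G f ·), sVert G f u := by
  calc sVert G f v ^ 2 = -sVert G f v * -sVert G f v := by ring
    _ ≤ #(G.neighborFinset v) * -sVert G f v :=
        mul_le_mul_of_nonneg_right (h.neg_sVert_le_degree v) (by omega)
    _ ≤ ∑ u ∈ G.neighborFinset v, sVert G f u := by
        rw [← nsmul_eq_mul]
        refine Finset.card_nsmul_le_sum _ _ _ fun u hu => ?_
        have huv := h.sVert_add_nonneg ((G.mem_neighborFinset v u).1 hu)
        omega
    _ ≤ _ := Finset.sum_le_sum_of_subset_of_nonneg (h.neighborFinset_subset hv)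
        fun u hu _ => (Finset.mem_filter.1 hu).2

/-- The absolute values of all vertex sums add up to at most `a ^ 2`, where `a` is the number of
vertices of nonnegative sum. -/
lemma IsSEDPair.sum_sub_sum_le_card_sq (h : IsSEDPair G f) :
    ∑ u ∈ univ.filter (0 ≤ sVert G f ·), sVert G f u -
      ∑ v ∈ univ.filter (¬ 0 ≤ sVert G f ·), sVert G f v ≤
      (#(univ.filter (0 ≤ sVert G f ·)) : ℤ) ^ 2 := by
  set A := univ.filter (0 ≤ sVert G f ·)
  set B := univ.filter (¬ 0 ≤ sVert G f ·)
  let w : V → V → ℤ := fun u v => if G.Adj u v then f s(u, v) else 0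
  have hrow (u : V) : sVert G f u = ∑ v ∈ A, w u v + ∑ v ∈ B, w u v := by
    rw [sVert_eq_sum_ite, Finset.sum_filter_add_sum_filter_not]
  have hB : ∑ v ∈ B, sVert G f v = ∑ u ∈ A, ∑ v ∈ B, w u v := by
    rw [Finset.sum_comm]
    refine Finset.sum_congr rfl fun v hv => ?_
    have hv' : ¬ 0 ≤ sVert G f v := (Finset.mem_filter.1 hv).2
    have hzero : ∑ u ∈ B, w v u = 0 := Finset.sum_eq_zero fun u hu => by
      have hu' : ¬ 0 ≤ sVert G f u := (Finset.mem_filter.1 hu).2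
      refine if_neg fun hadj => ?_
      have hvu := h.sVert_add_nonneg hadj
      omega
    rw [hrow, hzero, add_zero]
    refine Finset.sum_congr rfl fun u _ => ?_
    simp only [w, G.adj_comm v u, Sym2.eq_swap (a := v)]
  have hA : ∑ u ∈ A, sVert G f u = ∑ u ∈ A, ∑ v ∈ A, w u v + ∑ u ∈ A, ∑ v ∈ B, w u v := by
    rw [← Finset.sum_add_distrib]
    exact Finset.sum_congr rfl fun u _ => hrow u
  have hw (u v : V) : w u v ≤ 1 := by
    by_cases huv : G.Adj u v
    · simp only [w, if_pos huv]
      rcases h.1 s(u, v) (by simpa using huv) with hf | hf <;> omega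
    · simp [w, huv]
  have hle : ∑ u ∈ A, ∑ v ∈ A, w u v ≤ (#A : ℤ) ^ 2 :=
    (Finset.sum_le_sum fun u _ => Finset.sum_le_sum fun v _ => hw u v).trans (by simp [sq])
  linarith

end SignedGraph

/-- For every positive integer `n` and every SED-pair `(G, f)` of order `n`,
the total weight satisfies `s[(G,f)] ≥ -n² / 25`. -/
theorem sed_lower_bound_25 {V : Type*} [Fintype V] [DecidableEq V]
    (G : SimpleGraph V) [DecidableRel G.Adj] (f : Sym2 V → ℤ)
    (hn : 0 < Fintype.card V) (h : IsSEDPair G f) :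
    (sSum G f : ℝ) ≥ -(Fintype.card V : ℝ) ^ 2 / 25 := by
  have : Nonempty V := Fintype.card_pos_iff.1 hn
  have htwo := sum_sVert_eq_two_mul_sSum G f
  obtain ⟨v, hmin⟩ := Finite.exists_min (sVert G f)
  rcases le_or_gt 0 (sVert G f v) with hv | hv
  · have hnonneg : 0 ≤ sSum G f := by
      have := Finset.sum_nonneg fun u (_ : u ∈ univ) => hv.trans (hmin u)
      omega
    have hcast : (0 : ℝ) ≤ sSum G f := by exact_mod_cast hnonneg
    have hsq := sq_nonneg (Fintype.card V : ℝ)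
    linarith
  · have hsplit := Finset.sum_filter_add_sum_filter_not univ (0 ≤ sVert G f ·) (sVert G f)
    have hcard := Finset.card_filter_add_card_filter_not (s := univ) (0 ≤ sVert G f ·)
    have hsq := h.sVert_sq_le_sum hv
    have hsub := h.sum_sub_sum_le_card_sq
    have hdeg : -sVert G f v ≤ #(univ.filter (0 ≤ sVert G f ·)) :=
      (h.neg_sVert_le_degree v).trans
        (by exact_mod_cast Finset.card_le_card (h.neighborFinset_subset hv))
    have hneg : #(univ.filter (¬ 0 ≤ sVert G f ·)) * sVert G f v ≤
        ∑ u ∈ univ.filter (¬ 0 ≤ sVert G f ·), sVert G f u := by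
      rw [← nsmul_eq_mul]
      exact Finset.card_nsmul_le_sum _ _ _ fun u _ => hmin u
    rw [htwo] at hsplit
    rw [Finset.card_univ] at hcard
    generalize ∑ u ∈ univ.filter (0 ≤ sVert G f ·), sVert G f u = p at *
    generalize ∑ u ∈ univ.filter (¬ 0 ≤ sVert G f ·), sVert G f u = q at *
    generalize #(univ.filter (0 ≤ sVert G f ·)) = a at *
    generalize #(univ.filter (¬ 0 ≤ sVert G f ·)) = b at *
    generalize sVert G f v = m at *
    rify at hsplit hsq hsub hdeg hneg hv
    have hkey := sub_le_of_le_mul_of_add_le_sq (a := a) (b := b) (m := -m) (p := p) (t := -q)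
      (by positivity) (by linarith) hdeg (by linarith) (by linarith) (by linarith)
    rw [← hcard]
    push_cast
    linarith
end

section
/- Let p and q be positive integers with p² = 2q² + 1 and let n = 4(p+q)p + 1. Then there exists a SED-pair (G,f) of order n with s[(G,f)] ≤ −2p²q² + 4p² + 5pq. -/
open Finset

/-- The graph of nonzero entries of a symmetric matrix with zero diagonal. -/
def supportGraph {V : Type*} (W : V → V → ℤ) (hs : ∀ u v, W u v = W v u) (hd : ∀ v, W v v = 0) :
    SimpleGraph V where
  Adj u v := W u v ≠ 0
  symm := ⟨fun u v h => by rwa [hs v u]⟩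
  loopless := ⟨fun v h => h (hd v)⟩

/-- The edge weight given by a symmetric matrix. -/
def edgeWeight {V : Type*} (W : V → V → ℤ) (hs : ∀ u v, W u v = W v u) : Sym2 V → ℤ :=
  Sym2.lift ⟨W, hs⟩

section Weights

variable {V : Type*} [Fintype V] [DecidableEq V] (W : V → V → ℤ)
  (hs : ∀ u v, W u v = W v u) (hd : ∀ v, W v v = 0) [DecidableRel (supportGraph W hs hd).Adj]

/-- The vertex sum is the row sum of the weight matrix. -/
lemma sVert_supportGraph (v : V) :
    sVert (supportGraph W hs hd) (edgeWeight W hs) v = ∑ x, W v x := by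
  have himg : (supportGraph W hs hd).edgeFinset.filter (fun e => v ∈ e) =
      (univ.filter fun x => W v x ≠ 0).image fun x => s(v, x) := by
    ext e
    simp only [mem_filter, mem_image, mem_univ, true_and, SimpleGraph.mem_edgeFinset]
    constructor
    · rintro ⟨he, x, rfl⟩
      exact ⟨x, he, rfl⟩
    · rintro ⟨x, hx, rfl⟩
      exact ⟨hx, Sym2.mem_mk_left v x⟩
  rw [sVert, himg, sum_image (fun x _ y _ h => Sym2.congr_right.mp h)]
  exact sum_filter_ne_zero univ

/-- Handshake: the vertex sums add up to twice the total weight. -/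
lemma sum_sVert (G : SimpleGraph V) [DecidableRel G.Adj] (f : Sym2 V → ℤ) :
    ∑ v, sVert G f v = 2 * sSum G f := by
  simp only [sVert, sSum, sum_filter]
  rw [sum_comm, mul_sum]
  refine sum_congr rfl fun e he => ?_
  rw [← sum_filter, sum_const]
  have hcard : (univ.filter fun v => v ∈ e).card = 2 := by
    rw [← Sym2.card_toFinset_of_not_isDiag e
      (G.not_isDiag_of_mem_edgeSet (SimpleGraph.mem_edgeFinset.mp he))]
    congr 1
    ext v
    simp
  rw [hcard, two_nsmul, two_mul]

/-- The weight of the closed neighborhood of an edge, in terms of the sums at its endpoints. -/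
lemma sum_closedEdgeNeighborhood (G : SimpleGraph V) [DecidableRel G.Adj] (f : Sym2 V → ℤ)
    {u v : V} (h : G.Adj u v) :
    ∑ e' ∈ G.edgeFinset.filter (fun e' => ∃ x, x ∈ s(u, v) ∧ x ∈ e'), f e' =
      sVert G f u + sVert G f v - f s(u, v) := by
  have hunion : G.edgeFinset.filter (fun e' => ∃ x, x ∈ s(u, v) ∧ x ∈ e') =
      G.edgeFinset.filter (fun e => u ∈ e) ∪ G.edgeFinset.filter (fun e => v ∈ e) := by
    ext e
    simp only [mem_filter, mem_union, Sym2.mem_iff, or_and_right, exists_or, exists_eq_left]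
    tauto
  have hinter : G.edgeFinset.filter (fun e => u ∈ e) ∩ G.edgeFinset.filter (fun e => v ∈ e) =
      {s(u, v)} := by
    ext e
    simp only [mem_filter, mem_inter, mem_singleton]
    constructor
    · rintro ⟨⟨-, hu⟩, -, hv⟩
      exact (Sym2.mem_and_mem_iff h.ne).mp ⟨hu, hv⟩
    · rintro rfl
      simp [h]
  have hsum := sum_union_inter (s₁ := G.edgeFinset.filter fun e => u ∈ e)
    (s₂ := G.edgeFinset.filter fun e => v ∈ e) (f := f)
  rw [hinter, sum_singleton] at hsum
  rw [hunion, sVert, sVert]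
  linarith

end Weights

/-- A symmetric weight matrix with entries in `{-1, 0, 1}`, zero diagonal and suitable row sums
yields a SED-pair. -/
lemma exists_isSEDPair_of_weight {V : Type*} [Fintype V] {n : ℕ} (hn : Fintype.card V = n)
    (W : V → V → ℤ) (hs : ∀ u v, W u v = W v u) (hd : ∀ v, W v v = 0)
    (hW : ∀ u v, W u v = 0 ∨ W u v = 1 ∨ W u v = -1)
    (hrow : ∀ u v, W u v ≠ 0 → 1 + W u v ≤ ∑ x, W u x + ∑ x, W v x) :
    ∃ (G : SimpleGraph (Fin n)) (_ : DecidableRel G.Adj) (f : Sym2 (Fin n) → ℤ),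
      IsSEDPair G f ∧ 2 * sSum G f = ∑ u, ∑ v, W u v := by
  classical
  let φ : Fin n ≃ V := (Fintype.equivFinOfCardEq hn).symm
  let W' : Fin n → Fin n → ℤ := fun i j => W (φ i) (φ j)
  have hs' : ∀ i j, W' i j = W' j i := fun i j => hs _ _
  have hd' : ∀ i, W' i i = 0 := fun i => hd _
  have hsum : ∀ i, ∑ j, W' i j = ∑ x, W (φ i) x := fun i => φ.sum_comp (W (φ i))
  refine ⟨supportGraph W' hs' hd', Classical.decRel _, edgeWeight W' hs', ⟨?_, ?_⟩, ?_⟩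
  · intro e
    induction e with | _ u v
    intro he
    exact (hW (φ u) (φ v)).resolve_left (SimpleGraph.mem_edgeFinset.mp he)
  · intro e
    induction e with | _ u v
    intro he
    have huv : (supportGraph W' hs' hd').Adj u v := SimpleGraph.mem_edgeFinset.mp he
    rw [sum_closedEdgeNeighborhood _ _ huv, sVert_supportGraph, sVert_supportGraph, hsum, hsum]
    have hW' : edgeWeight W' hs' s(u, v) = W (φ u) (φ v) := rfl
    linarith [hrow (φ u) (φ v) huv]
  · rw [← sum_sVert]
    simp only [sVert_supportGraph, hsum]
    exact φ.sum_comp fun u => ∑ x, W u x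

/-- There is a `2q`-regular graph on `m` vertices whenever `2q < m`, given by its adjacency
matrix. -/
lemma exists_regular_adjacency (m q : ℕ) (h : 2 * q < m) :
    ∃ r : Fin m → Fin m → ℤ, (∀ i j, r i j = r j i) ∧ (∀ i, r i i = 0) ∧
      (∀ i j, r i j = 0 ∨ r i j = 1) ∧ ∀ i, ∑ j, r i j = 2 * q := by
  have : NeZero m := ⟨by omega⟩
  let c : Fin m → ℤ := fun x => if x.val ≠ 0 ∧ (x.val ≤ q ∨ m ≤ x.val + q) then 1 else 0
  have hc : ∀ x, c (-x) = c x := by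
    intro x
    have hx := x.isLt
    simp only [c, Fin.val_neg]
    by_cases h0 : x = 0
    · simp [h0]
    · have : x.val ≠ 0 := fun h => h0 (Fin.ext h)
      rw [if_neg h0]
      congr 1
      apply propext
      omega
  have hcard : ∑ x, c x = 2 * q := by
    rw [Fin.sum_univ_eq_sum_range
      (fun k => if k ≠ 0 ∧ (k ≤ q ∨ m ≤ k + q) then (1 : ℤ) else 0) m, ← sum_filter]
    have hS : (range m).filter (fun k => k ≠ 0 ∧ (k ≤ q ∨ m ≤ k + q)) =
        Ico 1 (q + 1) ∪ Ico (m - q) m := by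
      ext k
      simp only [mem_filter, mem_range, mem_union, mem_Ico]
      omega
    rw [hS, sum_union]
    · simp only [sum_const, Nat.card_Ico, nsmul_eq_mul, mul_one]
      omega
    · rw [Finset.disjoint_left]
      intro k
      simp only [mem_Ico]
      omega
  refine ⟨fun i j => c (i - j), fun i j => ?_, fun i => ?_, fun i j => ?_, fun i => ?_⟩
  · change c (i - j) = c (j - i)
    rw [← hc, neg_sub]
  · simp [c]
  · simp only [c]
    split_ifs <;> simp
  · rw [← hcard]
    exact (Equiv.subLeft i).sum_comp c

/-- The weight matrix on three blow-ups of `ι` and an isolated vertex: all weights are `1` inside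
the first blow-up and between the first two, and `-r` between the first and the third and inside
the second. -/
def blowupWeight {ι α β γ : Type*} [DecidableEq ι] [DecidableEq α] (r : ι → ι → ℤ) :
    (ι × α) ⊕ (ι × β) ⊕ (ι × γ) ⊕ Unit → (ι × α) ⊕ (ι × β) ⊕ (ι × γ) ⊕ Unit → ℤ
  | .inl a, .inl a' => if a = a' then 0 else 1
  | .inl _, .inr (.inl _) => 1
  | .inl a, .inr (.inr (.inl c)) => -r a.1 c.1
  | .inr (.inl _), .inl _ => 1
  | .inr (.inl b), .inr (.inl b') => -r b.1 b'.1
  | .inr (.inr (.inl c)), .inl a => -r a.1 c.1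
  | _, _ => 0

/-- Let `p, q` be positive integers with `p² = 2q² + 1` and let
`n = 4(p+q)p + 1`. Then there exists a SED-pair `(G, f)` of order `n` with
`s[(G,f)] ≤ -2p²q² + 4p² + 5pq`. -/
theorem sed_construction (p q : ℕ) (hp : 0 < p) (hq : 0 < q)
    (hpq : p ^ 2 = 2 * q ^ 2 + 1) (n : ℕ) (hn : n = 4 * (p + q) * p + 1) :
    ∃ (G : SimpleGraph (Fin n)) (_ : DecidableRel G.Adj) (f : Sym2 (Fin n) → ℤ),
      IsSEDPair G f ∧
      sSum G f ≤ -2 * (p : ℤ) ^ 2 * (q : ℤ) ^ 2 + 4 * (p : ℤ) ^ 2 + 5 * (p : ℤ) * (q : ℤ) := by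
  have hlt : q < p := by nlinarith
  have hpq' : (p : ℤ) ^ 2 = 2 * (q : ℤ) ^ 2 + 1 := by exact_mod_cast hpq
  have hq' : (1 : ℤ) ≤ q := by exact_mod_cast hq
  have hp' : (1 : ℤ) ≤ p := by exact_mod_cast hp
  obtain ⟨r, rsymm, rdiag, r01, rsum⟩ := exists_regular_adjacency (2 * p) q (by omega)
  let W := blowupWeight (α := Fin q) (β := Fin p) (γ := Fin (p + q)) r
  have hcol : ∀ j, ∑ i, r i j = 2 * q := fun j => by simp_rw [rsymm _ j, rsum]
  have hone : ∀ a : Fin (2 * p) × Fin q,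
      ∑ a', (if a = a' then (0 : ℤ) else 1) = 2 * p * q - 1 := by
    intro a
    have hsplit : ∀ a', (if a = a' then (0 : ℤ) else 1) = 1 - if a = a' then 1 else 0 := by
      intro a'
      split_ifs <;> simp
    simp [hsplit, sum_sub_distrib]
  have hA : ∀ a, ∑ x, W (.inl a) x = 2 * (q : ℤ) ^ 2 + 1 := by
    intro a
    simp only [W, Fintype.sum_sum_type, blowupWeight, hone]
    simp only [Fintype.sum_prod_type, sum_const, card_univ, Fintype.card_fin, nsmul_eq_mul,
      sum_neg_distrib, ← mul_sum, rsum]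
    simp
    linarith
  have hB : ∀ b, ∑ x, W (.inr (.inl b)) x = 0 := by
    intro b
    simp only [W, Fintype.sum_sum_type, blowupWeight]
    simp only [Fintype.sum_prod_type, sum_const, card_univ, Fintype.card_fin, nsmul_eq_mul,
      sum_neg_distrib, ← mul_sum, rsum]
    simp
    ring
  have hC : ∀ c, ∑ x, W (.inr (.inr (.inl c))) x = -2 * (q : ℤ) ^ 2 := by
    intro c
    simp only [W, Fintype.sum_sum_type, blowupWeight]
    simp only [Fintype.sum_prod_type, sum_const, card_univ, Fintype.card_fin, nsmul_eq_mul,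
      sum_neg_distrib, ← mul_sum, hcol]
    simp
    ring
  have hU : ∀ u, ∑ x, W (.inr (.inr (.inr u))) x = 0 := by
    intro u
    simp [W, blowupWeight]
  obtain ⟨G, hG, f, hf, hsum⟩ := exists_isSEDPair_of_weight (n := n) (by simp [hn]; ring) W
    (by
      rintro (a | b | c | u) (a' | b' | c' | u') <;> simp only [W, blowupWeight, eq_comm]
      rw [rsymm])
    (by rintro (a | b | c | u) <;> simp [W, blowupWeight, rdiag])
    (by
      rintro (a | b | c | u) (a' | b' | c' | u') <;> simp only [W, blowupWeight] <;>
        first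
        | (split_ifs <;> simp)
        | (simp; done)
        | (rcases r01 _ _ with h | h <;> rw [h] <;> simp))
    (by
      rintro (a | b | c | u) (a' | b' | c' | u') h <;> simp only [hA, hB, hC, hU] <;>
        simp only [W, blowupWeight, ne_eq, not_true_eq_false] at h ⊢
      · split_ifs <;> nlinarith
      · nlinarith
      · rcases r01 a.1 c'.1 with h' | h' <;> simp_all
      · nlinarith
      · rcases r01 b.1 b'.1 with h' | h' <;> simp_all
      · rcases r01 a'.1 c.1 with h' | h' <;> simp_all)
  refine ⟨G, hG, f, hf, ?_⟩
  rw [Fintype.sum_sum_type (fun u => ∑ x, W u x),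
    Fintype.sum_sum_type (fun u => ∑ x, W (.inr u) x),
    Fintype.sum_sum_type (fun u => ∑ x, W (.inr (.inr u)) x)] at hsum
  simp only [hA, hB, hC, hU] at hsum
  simp at hsum
  nlinarith
end

section
/- Let (G,f) be a SED-pair. Then the set V_− = {v∈V : s_v < 0} is an independent set in G, i.e., no edge of G joins two vertices of V_−. -/
open Finset

/-- In a SED-pair `(G, f)`, the set `V₋ = {v : s_v < 0}` is independent:
no edge of `G` joins two vertices of `V₋`. -/
theorem sed_Vneg_independent {V : Type*} [Fintype V] [DecidableEq V]
    (G : SimpleGraph V) [DecidableRel G.Adj] (f : Sym2 V → ℤ)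
    (h : IsSEDPair G f) (u v : V) (huv : G.Adj u v) :
    ¬(sVert G f u < 0 ∧ sVert G f v < 0) := by
  rintro ⟨hu, hv⟩
  have he : s(u, v) ∈ G.edgeFinset := by simpa using huv
  have hN := h.2 _ he
  have hunion : G.edgeFinset.filter (fun e' => ∃ w, w ∈ s(u, v) ∧ w ∈ e') =
      G.edgeFinset.filter (fun e => u ∈ e) ∪ G.edgeFinset.filter (fun e => v ∈ e) := by
    ext e
    simp [and_or_left]
  have hinter : G.edgeFinset.filter (fun e => u ∈ e) ∩ G.edgeFinset.filter (fun e => v ∈ e) =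
      {s(u, v)} := by
    ext e
    rw [← filter_and, mem_filter, Sym2.mem_and_mem_iff huv.ne, mem_singleton]
    exact ⟨fun h => h.2, fun h => ⟨h ▸ he, h⟩⟩
  have hsum := sum_union_inter (s₁ := G.edgeFinset.filter (fun e => u ∈ e))
    (s₂ := G.edgeFinset.filter (fun e => v ∈ e)) (f := f)
  rw [← hunion, hinter, sum_singleton] at hsum
  unfold sVert at hu hv
  rcases h.1 _ he with hf | hf <;> linarith
end

section
/- Let (G,f) be a SED-pair with V_− nonempty, and let x = max_{v∈V_−}(−s_v). Then ∑_{v∈V} s_v ≥ 2x² − |V_+|². -/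
open Finset

/-- The weight of the pair `u, v`: the value of `f` on the edge `uv`, and `0` if `u, v` are not
adjacent. -/
def pairWeight {V : Type*} (G : SimpleGraph V) [DecidableRel G.Adj] (f : Sym2 V → ℤ)
    (u v : V) : ℤ :=
  if G.Adj u v then f s(u, v) else 0

theorem pairWeight_comm {V : Type*} (G : SimpleGraph V) [DecidableRel G.Adj] (f : Sym2 V → ℤ)
    (u v : V) : pairWeight G f u v = pairWeight G f v u := by
  simp only [pairWeight, G.adj_comm u v, Sym2.eq_swap (a := u)]

theorem sVert_eq_sum_pairWeight {V : Type*} [Fintype V] [DecidableEq V] (G : SimpleGraph V)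
    [DecidableRel G.Adj] (f : Sym2 V → ℤ) (v : V) :
    sVert G f v = ∑ u, pairWeight G f v u := by
  unfold sVert pairWeight
  rw [← Finset.sum_filter]
  symm
  refine Finset.sum_bij (fun u _ => s(v, u)) ?_ ?_ ?_ ?_
  · intro u hu
    simpa using hu
  · intro a _ b _ hab
    exact Sym2.congr_right.1 hab
  · intro e he
    simp only [mem_filter, SimpleGraph.mem_edgeFinset] at he
    obtain ⟨he, u, rfl⟩ := he
    exact ⟨u, by simpa using he, rfl⟩
  · intro u _
    rfl

theorem IsSEDPair.one_add_le_sVert_add_sVert {V : Type*} [Fintype V] [DecidableEq V]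
    {G : SimpleGraph V} [DecidableRel G.Adj] {f : Sym2 V → ℤ} (h : IsSEDPair G f) {u v : V}
    (huv : G.Adj u v) : 1 + f s(u, v) ≤ sVert G f u + sVert G f v := by
  have hN := h.2 s(u, v) (by simpa using huv)
  have hunion : G.edgeFinset.filter (fun e => ∃ w, w ∈ s(u, v) ∧ w ∈ e) =
      G.edgeFinset.filter (fun e => u ∈ e) ∪ G.edgeFinset.filter (fun e => v ∈ e) := by
    ext e
    simp only [mem_filter, mem_union, Sym2.mem_iff, or_and_right, exists_or, exists_eq_left,
      and_or_left]
  have hinter : G.edgeFinset.filter (fun e => u ∈ e) ∩ G.edgeFinset.filter (fun e => v ∈ e) =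
      {s(u, v)} := by
    ext e
    simp only [mem_filter, mem_inter, mem_singleton, SimpleGraph.mem_edgeFinset]
    constructor
    · rintro ⟨⟨_, hu⟩, _, hv⟩
      exact (Sym2.mem_and_mem_iff huv.ne).1 ⟨hu, hv⟩
    · rintro rfl
      simpa using huv
  have hsum := Finset.sum_union_inter (s₁ := G.edgeFinset.filter (fun e => u ∈ e))
    (s₂ := G.edgeFinset.filter (fun e => v ∈ e)) (f := f)
  rw [hinter, sum_singleton, ← hunion] at hsum
  unfold sVert
  linarith

theorem IsSEDPair.pairWeight_le_one {V : Type*} [Fintype V] [DecidableEq V]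
    {G : SimpleGraph V} [DecidableRel G.Adj] {f : Sym2 V → ℤ} (h : IsSEDPair G f) (u v : V) :
    pairWeight G f u v ≤ 1 := by
  unfold pairWeight
  split_ifs with huv
  · have := h.1 s(u, v) (by simpa using huv)
    omega
  · exact zero_le_one

/-- Two vertices with negative `sVert` are not adjacent. -/
theorem IsSEDPair.pairWeight_eq_zero {V : Type*} [Fintype V] [DecidableEq V]
    {G : SimpleGraph V} [DecidableRel G.Adj] {f : Sym2 V → ℤ} (h : IsSEDPair G f) {u v : V}
    (hu : sVert G f u < 0) (hv : sVert G f v < 0) : pairWeight G f u v = 0 := by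
  refine if_neg fun huv => ?_
  have := h.1 s(u, v) (by simpa using huv)
  have := h.one_add_le_sVert_add_sVert huv
  omega

theorem IsSEDPair.sVert_eq_sum_nonneg {V : Type*} [Fintype V] [DecidableEq V]
    {G : SimpleGraph V} [DecidableRel G.Adj] {f : Sym2 V → ℤ} (h : IsSEDPair G f) {v : V}
    (hv : sVert G f v < 0) :
    sVert G f v = ∑ u with 0 ≤ sVert G f u, pairWeight G f v u := by
  rw [sVert_eq_sum_pairWeight]
  refine (sum_subset (filter_subset _ _) fun u _ hu => h.pairWeight_eq_zero hv ?_).symm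
  simpa using hu

theorem IsSEDPair.sq_sVert_le_sum_nonneg {V : Type*} [Fintype V] [DecidableEq V]
    {G : SimpleGraph V} [DecidableRel G.Adj] {f : Sym2 V → ℤ} (h : IsSEDPair G f) {v : V}
    (hv : sVert G f v < 0) :
    sVert G f v ^ 2 ≤ ∑ u with 0 ≤ sVert G f u, sVert G f u := by
  rw [sq]
  nth_rw 1 [h.sVert_eq_sum_nonneg hv]
  rw [sum_mul]
  refine sum_le_sum fun u hu => ?_
  have hu : 0 ≤ sVert G f u := by simpa using hu
  unfold pairWeight
  split_ifs with huv
  · have hle := h.one_add_le_sVert_add_sVert huv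
    rcases h.1 s(v, u) (by simpa using huv) with hf | hf <;> rw [hf] at hle ⊢ <;> linarith
  · simpa using hu

theorem IsSEDPair.sum_nonneg_le_sum_neg_add {V : Type*} [Fintype V] [DecidableEq V]
    {G : SimpleGraph V} [DecidableRel G.Adj] {f : Sym2 V → ℤ} (h : IsSEDPair G f) :
    ∑ u with 0 ≤ sVert G f u, sVert G f u ≤
      ∑ v with ¬ 0 ≤ sVert G f v, sVert G f v +
        ((univ.filter (fun v => 0 ≤ sVert G f v)).card : ℤ) ^ 2 := by
  have hneg : ∑ v with ¬ 0 ≤ sVert G f v, sVert G f v =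
      ∑ u with 0 ≤ sVert G f u, ∑ v with ¬ 0 ≤ sVert G f v, pairWeight G f u v := by
    rw [sum_comm]
    refine sum_congr rfl fun v hv => ?_
    rw [h.sVert_eq_sum_nonneg (by simpa using hv)]
    exact sum_congr rfl fun u _ => pairWeight_comm G f v u
  have hsq : ((univ.filter (fun v => 0 ≤ sVert G f v)).card : ℤ) ^ 2 =
      ∑ u with 0 ≤ sVert G f u, ∑ v with 0 ≤ sVert G f v, (1 : ℤ) := by
    simp [sq]
  rw [hneg, hsq, ← sum_add_distrib]
  refine sum_le_sum fun u _ => ?_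
  conv_lhs => rw [sVert_eq_sum_pairWeight,
    ← sum_filter_add_sum_filter_not univ (fun v => 0 ≤ sVert G f v), add_comm]
  gcongr
  exact h.pairWeight_le_one _ _

/-- Let `(G, f)` be a SED-pair with `V₋ = {v : s_v < 0}` nonempty and
`x = max_{v ∈ V₋} (-s_v)`. Then `∑_{v ∈ V} s_v ≥ 2x² - |V₊|²`. -/
theorem sed_total_sum_ge {V : Type*} [Fintype V] [DecidableEq V]
    (G : SimpleGraph V) [DecidableRel G.Adj] (f : Sym2 V → ℤ)
    (h : IsSEDPair G f)
    (hne : (univ.filter (fun v => sVert G f v < 0)).Nonempty)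
    (x : ℤ)
    (hx : x = (univ.filter (fun v => sVert G f v < 0)).sup' hne (fun v => -sVert G f v)) :
    ∑ v : V, sVert G f v ≥
      2 * x ^ 2 - ((univ.filter (fun v => 0 ≤ sVert G f v)).card : ℤ) ^ 2 := by
  obtain ⟨v, hv, hxv⟩ := exists_mem_eq_sup' hne (fun v => -sVert G f v)
  have hsq := h.sq_sVert_le_sum_nonneg (v := v) (by simpa using hv)
  have hle := h.sum_nonneg_le_sum_neg_add
  rw [hx, hxv, neg_sq, ← sum_filter_add_sum_filter_not univ (fun v => 0 ≤ sVert G f v)]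
  linarith
end

section
/- For all real numbers y, k with 0 ≤ y ≤ 1 and 0 ≤ k ≤ 1, one has max(y² − k²/2, −y(1−k−y)/2) ≥ −1/25, and equality holds at y = 1/5, k = 2/5. Consequently, the minimum over [0,1]² of max(y² − k²/2, −y(1−k−y)/2) equals −1/25. -/
theorem neg_one_div_le_max {y k : ℝ} (hy : 0 ≤ y) (hk : 0 ≤ k) :
    -1 / 25 ≤ max (y ^ 2 - k ^ 2 / 2) (-(y * (1 - k - y)) / 2) := by
  by_contra! h
  obtain ⟨h₁, h₂⟩ := max_lt_iff.mp h
  have hyk : y + 1 / 5 < k :=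
    lt_of_pow_lt_pow_left₀ 2 hk (by nlinarith [sq_nonneg (y - 1 / 5)])
  nlinarith [mul_le_mul_of_nonneg_left hyk.le hy, sq_nonneg (y - 1 / 5)]

/-- For all `y, k ∈ [0,1]`, `max (y² - k²/2) (-y(1-k-y)/2) ≥ -1/25`,
with equality at `y = 1/5`, `k = 2/5`; consequently the minimum over `[0,1]²` of
`max (y² - k²/2) (-y(1-k-y)/2)` equals `-1/25`. -/
theorem minimax_unit_square :
    (∀ y k : ℝ, 0 ≤ y → y ≤ 1 → 0 ≤ k → k ≤ 1 →
      max (y ^ 2 - k ^ 2 / 2) (-(y * (1 - k - y)) / 2) ≥ -1 / 25) ∧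
    max ((1 / 5 : ℝ) ^ 2 - (2 / 5 : ℝ) ^ 2 / 2)
      (-((1 / 5 : ℝ) * (1 - 2 / 5 - 1 / 5)) / 2) = -1 / 25 ∧
    IsLeast {z : ℝ | ∃ y k : ℝ, 0 ≤ y ∧ y ≤ 1 ∧ 0 ≤ k ∧ k ≤ 1 ∧
      z = max (y ^ 2 - k ^ 2 / 2) (-(y * (1 - k - y)) / 2)} (-1 / 25) := by
  refine ⟨fun y k hy _ hk _ => neg_one_div_le_max hy hk, by norm_num,
    ⟨1 / 5, 2 / 5, by norm_num, by norm_num, by norm_num, by norm_num, by norm_num⟩, ?_⟩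
  rintro z ⟨y, k, hy, -, hk, -, rfl⟩
  exact neg_one_div_le_max hy hk
end

section
/- Define T(y) = y − y·(y + √(5y² + 4y))/2 for real y. Then T(y) ≤ 2/25 for every y ∈ [0,1], with equality if and only if y = 1/5. -/
/-- Away from `y = 1/5`, the bound `T(y) < 2/25` is strict. -/
theorem T_lt_of_ne {y : ℝ} (hy0 : 0 ≤ y) (hne : y ≠ 1 / 5) :
    y - y * (y + Real.sqrt (5 * y ^ 2 + 4 * y)) / 2 < 2 / 25 := by
  have hs : Real.sqrt (5 * y ^ 2 + 4 * y) ^ 2 = 5 * y ^ 2 + 4 * y :=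
    Real.sq_sqrt (by positivity)
  have hs0 := Real.sqrt_nonneg (5 * y ^ 2 + 4 * y)
  set s := Real.sqrt (5 * y ^ 2 + 4 * y)
  have hys : 0 ≤ y * s := mul_nonneg hy0 hs0
  suffices h : 2 * y - y ^ 2 - 4 / 25 < y * s by linarith
  rcases lt_or_ge (2 * y - y ^ 2 - 4 / 25) 0 with hR | hR
  · exact hR.trans_le hys
  · refine lt_of_pow_lt_pow_left₀ 2 hys ?_
    have hy : 2 / 25 ≤ y := by nlinarith [sq_nonneg y]
    have hprod : 0 < (y - 1 / 5) ^ 2 * (4 * y ^ 2 + 48 / 5 * y - 16 / 25) :=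
      mul_pos (sq_pos_iff.mpr (sub_ne_zero.mpr hne)) (by nlinarith)
    rw [mul_pow, hs]
    linarith

/-- For `T(y) = y - y·(y + √(5y² + 4y))/2`, one has `T(y) ≤ 2/25` for
every `y ∈ [0,1]`, with equality if and only if `y = 1/5`. -/
theorem T_le_and_eq_iff (y : ℝ) (hy0 : 0 ≤ y) (hy1 : y ≤ 1) :
    y - y * (y + Real.sqrt (5 * y ^ 2 + 4 * y)) / 2 ≤ 2 / 25 ∧
    (y - y * (y + Real.sqrt (5 * y ^ 2 + 4 * y)) / 2 = 2 / 25 ↔ y = 1 / 5) := by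
  by_cases h : y = 1 / 5
  · subst h
    have hs : Real.sqrt (5 * (1 / 5 : ℝ) ^ 2 + 4 * (1 / 5)) = 1 := by
      norm_num
    rw [hs]
    norm_num
  · have hlt := T_lt_of_ne hy0 h
    exact ⟨hlt.le, fun he => absurd he hlt.ne, fun he => absurd he h⟩
end

section
/- Define G(α) = α^{3/2} and H(α) = (1 − √(1−α))·(√(1−α) + α) for real α ∈ (0,1). Then G(α) < H(α) for all α ∈ (0, 1/2) and G(α) > H(α) for all α ∈ (1/2, 1). -/
/-- For `α ∈ [0, 1]`, the difference `H(α) - G(α)` factors in terms of `√α` and `√(1-α)`. -/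
theorem H_sub_G_eq {α : ℝ} (h0 : 0 ≤ α) (h1 : α ≤ 1) :
    (1 - Real.sqrt (1 - α)) * (Real.sqrt (1 - α) + α) - α ^ ((3 : ℝ) / 2) =
      (Real.sqrt (1 - α) - Real.sqrt α) * ((1 - Real.sqrt (1 - α)) * (1 - Real.sqrt α)) := by
  have hG : α ^ ((3 : ℝ) / 2) = Real.sqrt α ^ 3 := by
    rw [Real.sqrt_eq_rpow, ← Real.rpow_natCast, ← Real.rpow_mul h0]
    norm_num
  have hs : Real.sqrt α ^ 2 = α := Real.sq_sqrt h0
  have hc : Real.sqrt (1 - α) ^ 2 = 1 - α := Real.sq_sqrt (by linarith)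
  rw [hG]
  generalize Real.sqrt (1 - α) = c at *
  generalize Real.sqrt α = s at *
  subst hs
  linear_combination -s * hc

/-- For `α ∈ (0, 1)`, the factor `(1 - √(1-α))(1 - √α)` is positive. -/
theorem one_sub_sqrt_mul_one_sub_sqrt_pos {α : ℝ} (h0 : 0 < α) (h1 : α < 1) :
    0 < (1 - Real.sqrt (1 - α)) * (1 - Real.sqrt α) :=
  mul_pos (sub_pos.2 ((Real.sqrt_lt' one_pos).2 (by linarith)))
    (sub_pos.2 ((Real.sqrt_lt' one_pos).2 (by linarith)))

/-- With `G(α) = α^(3/2)` and `H(α) = (1 - √(1-α))(√(1-α) + α)`,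
one has `G(α) < H(α)` for `α ∈ (0, 1/2)` and `G(α) > H(α)` for `α ∈ (1/2, 1)`. -/
theorem G_H_comparison :
    (∀ α : ℝ, 0 < α → α < 1 / 2 →
      α ^ ((3 : ℝ) / 2) < (1 - Real.sqrt (1 - α)) * (Real.sqrt (1 - α) + α)) ∧
    (∀ α : ℝ, 1 / 2 < α → α < 1 →
      (1 - Real.sqrt (1 - α)) * (Real.sqrt (1 - α) + α) < α ^ ((3 : ℝ) / 2)) := by
  refine ⟨fun α h0 h1 => ?_, fun α h0 h1 => ?_⟩
  · rw [← sub_pos, H_sub_G_eq h0.le (by linarith)]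
    exact mul_pos (sub_pos.2 (Real.sqrt_lt_sqrt h0.le (by linarith)))
      (one_sub_sqrt_mul_one_sub_sqrt_pos h0 (by linarith))
  · rw [← sub_neg, H_sub_G_eq (by linarith) h1.le]
    exact mul_neg_of_neg_of_pos
      (sub_neg.2 (Real.sqrt_lt_sqrt (by linarith) (by linarith)))
      (one_sub_sqrt_mul_one_sub_sqrt_pos (by linarith) h1)
end
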